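/- arXiv:1110.5625 — 2 statements merged into one kernel-verified Lean document; each statement's English description precedes it below -/
import Mathlib

section
/- Let k be a commutative artinian ring with radical 𝔯, E = E(k/𝔯) an injective envelope of k/𝔯, and D = Hom_k(−, E) : mod k → mod k. Let C be a k-linear, Hom-finite, essentially small, idempotent complete additive category. Then C is a dualising k-variety if and only if both of the following hold: (1) C has weak kernels and weak cokernels; (2) for every object C of C, the functors D Hom_C(−, C) : C^op → mod k and D Hom_C(C, −) : C → mod k are finitely presented. -/
open CategoryTheory CategoryTheory.Limits Opposite

universe v u

/-- `α'` factors through `α` (both morphisms ending at the same object). -/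
def FactorsThru {C : Type*} [Category C] {X' X Y : C} (α' : X' ⟶ Y) (α : X ⟶ Y) : Prop :=
  ∃ φ : X' ⟶ X, φ ≫ α = α'

/-- A morphism `α : X ⟶ Y` is right determined by an object `c` if for every morphism
`α' : X' ⟶ Y`, `α'` factors through `α` iff for every `φ : c ⟶ X'` the composite
`φ ≫ α'` factors through `α`. -/
def RightDetermined {C : Type*} [Category C] {X Y : C} (α : X ⟶ Y) (c : C) : Prop :=
  ∀ ⦃X' : C⦄ (α' : X' ⟶ Y),
    FactorsThru α' α ↔ ∀ φ : c ⟶ X', FactorsThru (φ ≫ α') α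

/-- A morphism is left determined by `c` if it is right determined by `c` as a morphism
of the opposite category. -/
def LeftDetermined {C : Type*} [Category C] {X Y : C} (α : X ⟶ Y) (c : C) : Prop :=
  RightDetermined α.op (op c)

/-- `α : X ⟶ Y` is right minimal if every `φ : X ⟶ X` with `φ ≫ α = α` is an isomorphism. -/
def RightMinimal {C : Type*} [Category C] {X Y : C} (α : X ⟶ Y) : Prop :=
  ∀ φ : X ⟶ X, φ ≫ α = α → IsIso φ

/-- The image of the induced map `Hom(c, X) → Hom(c, Y)`, as a subset of `Hom(c, Y)`. -/
def ImHom {C : Type*} [Category C] (c : C) {X Y : C} (α : X ⟶ Y) : Set (c ⟶ Y) :=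
  {g : c ⟶ Y | ∃ f : c ⟶ X, f ≫ α = g}
/-- `f` is a weak kernel of `g`: `f ≫ g = 0` and every morphism killing `g` factors
through `f` (equivalently, `Hom(−,X) → Hom(−,Y) → Hom(−,Z)` is exact). -/
def IsWeakKernel {C : Type*} [Category C] [Preadditive C] {X Y Z : C}
    (f : X ⟶ Y) (g : Y ⟶ Z) : Prop :=
  f ≫ g = 0 ∧ ∀ ⦃A : C⦄ (h : A ⟶ Y), h ≫ g = 0 → ∃ t : A ⟶ X, t ≫ f = h

/-- The category `C` has weak kernels. -/
def HasWeakKernels (C : Type*) [Category C] [Preadditive C] : Prop :=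
  ∀ ⦃Y Z : C⦄ (g : Y ⟶ Z), ∃ (X : C) (f : X ⟶ Y), IsWeakKernel f g

/-- `g` is a weak cokernel of `f`: `f ≫ g = 0` and every morphism killed by `f` factors
through `g` (equivalently, `Hom(Z,−) → Hom(Y,−) → Hom(X,−)` is exact). -/
def IsWeakCokernel {C : Type*} [Category C] [Preadditive C] {X Y Z : C}
    (f : X ⟶ Y) (g : Y ⟶ Z) : Prop :=
  f ≫ g = 0 ∧ ∀ ⦃A : C⦄ (h : Y ⟶ A), f ≫ h = 0 → ∃ t : Z ⟶ A, g ≫ t = h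

/-- The category `C` has weak cokernels. -/
def HasWeakCokernels (C : Type*) [Category C] [Preadditive C] : Prop :=
  ∀ ⦃X Y : C⦄ (f : X ⟶ Y), ∃ (Z : C) (g : Y ⟶ Z), IsWeakCokernel f g
/-- `E` is an injective envelope of `k/𝔯` over `k`, where `𝔯` is the Jacobson radical of `k`:
`E` is an injective `k`-module and there is an injective `k`-linear map
`k/𝔯 →ₗ[k] E` whose image is an essential submodule of `E`. -/
def IsInjectiveEnvelopeOfResidueField (k : Type v) [CommRing k]
    (E : Type v) [AddCommGroup E] [Module k E] : Prop :=
  Module.Injective k E ∧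
    ∃ i : (k ⧸ (⊥ : Ideal k).jacobson) →ₗ[k] E,
      Function.Injective i ∧
      ∀ N : Submodule k E, N ≠ ⊥ → N ⊓ LinearMap.range i ≠ ⊥
section ModCat

variable (k : Type v) [CommRing k] (E : Type v) [AddCommGroup E] [Module k E]
variable (C : Type u) [Category.{v} C] [Preadditive C] [Linear k C]

/-- A functor `F : Cᵒᵖ ⥤ ModuleCat k` is finitely presented if there is an exact sequence
`Hom_C(−, X) → Hom_C(−, Y) → F → 0`, i.e. `F` is a cokernel of a morphism between
representable functors.  (`mod C` is the full subcategory of such functors.) -/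
def IsFPContra (F : Cᵒᵖ ⥤ ModuleCat.{v} k) : Prop :=
  ∃ (X Y : C) (p : X ⟶ Y), Nonempty (F ≅ Limits.cokernel ((linearYoneda k C).map p))

/-- A functor `G : C ⥤ ModuleCat k` is finitely presented if there is an exact sequence
`Hom_C(Y, −) → Hom_C(X, −) → G → 0`, i.e. `G` is a cokernel of a morphism between
corepresentable functors.  (`mod (Cᵒᵖ)` is the full subcategory of such functors.) -/
def IsFPCov (G : C ⥤ ModuleCat.{v} k) : Prop :=
  ∃ (X Y : C) (p : X ⟶ Y), Nonempty (G ≅ Limits.cokernel ((linearCoyoneda k C).map p.op))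

/-- The duality `D = Hom_k(−, E) : (ModuleCat k)ᵒᵖ ⥤ ModuleCat k`. -/
noncomputable abbrev DModule : (ModuleCat.{v} k)ᵒᵖ ⥤ ModuleCat.{v} k :=
  (linearYoneda k (ModuleCat.{v} k)).obj (ModuleCat.of k E)

/-- The functor `F ↦ D ∘ F` from presheaves to copresheaves. -/
noncomputable def dualizeContra :
    (Cᵒᵖ ⥤ ModuleCat.{v} k)ᵒᵖ ⥤ (C ⥤ ModuleCat.{v} k) :=
  Functor.opHom Cᵒᵖ (ModuleCat.{v} k) ⋙
    (Functor.whiskeringLeft C Cᵒᵖᵒᵖ (ModuleCat.{v} k)ᵒᵖ).obj (opOp C) ⋙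
    (Functor.whiskeringRight C (ModuleCat.{v} k)ᵒᵖ (ModuleCat.{v} k)).obj (DModule k E)

/-- The functor `G ↦ D ∘ G` from copresheaves to presheaves. -/
noncomputable def dualizeCov :
    (C ⥤ ModuleCat.{v} k)ᵒᵖ ⥤ (Cᵒᵖ ⥤ ModuleCat.{v} k) :=
  Functor.opHom C (ModuleCat.{v} k) ⋙
    (Functor.whiskeringRight Cᵒᵖ (ModuleCat.{v} k)ᵒᵖ (ModuleCat.{v} k)).obj (DModule k E)

/-- `C` is a dualising `k`-variety: `F ↦ D ∘ F` sends finitely presented presheaves to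
finitely presented copresheaves and the induced functor `(mod C)ᵒᵖ ⥤ mod (Cᵒᵖ)` is an
equivalence of categories. -/
noncomputable def IsDualisingVariety : Prop :=
  ∃ h : ∀ F : ObjectProperty.FullSubcategory (IsFPContra k C),
      IsFPCov k C ((dualizeContra k E C).obj (op F.obj)),
    (ObjectProperty.lift (IsFPCov k C)
      ((ObjectProperty.ι (IsFPContra k C)).op ⋙ dualizeContra k E C)
      (fun F => h F.unop)).IsEquivalence

end ModCat

section MatlisDuality

variable {k : Type v} [CommRing k] {E : Type v} [AddCommGroup E] [Module k E]

/-- In an artinian ring every maximal ideal `m` is comaximal with the intersection of the other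
maximal ideals. -/
theorem Ideal.IsMaximal.exists_add_eq_one_of_isArtinianRing [IsArtinianRing k]
    (m : Ideal k) [hm : m.IsMaximal] :
    ∃ a ∈ m, ∃ j : k, a + j = 1 ∧ ∀ n : Ideal k, n.IsMaximal → n ≠ m → j ∈ n := by
  classical
  have : Fintype (MaximalSpectrum k) := Fintype.ofFinite _
  have h : m ⊔ ⨅ n ∈ Finset.univ.filter (fun n : MaximalSpectrum k => n.asIdeal ≠ m),
      n.asIdeal = ⊤ := by
    refine Ideal.sup_iInf_eq_top fun n hn => ?_
    exact hm.coprime_of_ne n.isMaximal (by simpa using (Finset.mem_filter.1 hn).2.symm)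
  obtain ⟨a, ha, j, hj, haj⟩ := Submodule.mem_sup.1 ((Ideal.eq_top_iff_one _).1 h)
  refine ⟨a, ha, j, haj, fun n hn hnm => ?_⟩
  simp only [Submodule.mem_iInf] at hj
  exact hj ⟨n, hn⟩ (by simpa using hnm)

/-- The `m`-torsion of an injective envelope of `k/𝔯` is a nonzero cyclic module. -/
theorem IsInjectiveEnvelopeOfResidueField.exists_torsion_generator [IsArtinianRing k]
    (hE : IsInjectiveEnvelopeOfResidueField k E) (m : Ideal k) [hm : m.IsMaximal] :
    ∃ t : E, t ≠ 0 ∧ (∀ a ∈ m, a • t = 0) ∧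
      ∀ e : E, (∀ a ∈ m, a • e = 0) → ∃ x : k, x • t = e := by
  obtain ⟨-, i, hi, hess⟩ := hE
  obtain ⟨a, ha, j, haj, hj⟩ := Ideal.IsMaximal.exists_add_eq_one_of_isArtinianRing m
  have hjm : j ∉ m := fun h => hm.ne_top ((Ideal.eq_top_iff_one _).2 (haj ▸ m.add_mem ha h))
  have hr : (⊥ : Ideal k).jacobson ≤ m := sInf_le ⟨bot_le, hm⟩
  refine ⟨i (Ideal.Quotient.mk _ j), ?_, ?_, ?_⟩
  · rw [Ne, map_eq_zero_iff i hi, Ideal.Quotient.eq_zero_iff_mem]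
    exact fun h => hjm (hr h)
  · intro b hb
    rw [← map_smul, map_eq_zero_iff i hi]
    change Ideal.Quotient.mk _ (b * j) = 0
    rw [Ideal.Quotient.eq_zero_iff_mem]
    refine Ideal.mem_sInf.2 fun {n} hn => ?_
    by_cases hnm : n = m
    · exact hnm ▸ m.mul_mem_right _ hb
    · exact n.mul_mem_left _ (hj n hn.2 hnm)
  · intro e he
    by_cases he0 : e = 0
    · exact ⟨0, by simp [he0]⟩
    obtain ⟨y, hy, hy0⟩ := (Submodule.ne_bot_iff _).1
      (hess (Submodule.span k {e}) (by simpa [Submodule.span_singleton_eq_bot] using he0))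
    obtain ⟨⟨c, rfl⟩, q, hq⟩ : (∃ c : k, c • e = y) ∧ ∃ q, i q = y :=
      ⟨Submodule.mem_span_singleton.1 hy.1, hy.2⟩
    have hc : c ∉ m := fun h => hy0 (he c h)
    obtain ⟨d, b, hb, hd⟩ := hm.exists_inv hc
    obtain ⟨x, hx⟩ := Ideal.Quotient.mk_surjective (d • q)
    have hex : i (Ideal.Quotient.mk _ x) = e := by
      rw [hx, map_smul, hq, smul_smul]
      have : d * c = 1 - b := by rw [← hd]; ring
      rw [this, sub_smul, he b hb]; simp
    refine ⟨x, ?_⟩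
    rw [← hex, ← map_smul]
    congr 1
    change Ideal.Quotient.mk _ (x * j) = _
    rw [Ideal.Quotient.eq]
    have hax : Ideal.Quotient.mk (⊥ : Ideal k).jacobson (a * x) = 0 := by
      apply hi
      rw [map_zero]
      change i (a • Ideal.Quotient.mk _ x) = 0
      rw [map_smul, hex, he a ha]
    rw [Ideal.Quotient.eq_zero_iff_mem] at hax
    have : x * j - x = -(a * x) := by linear_combination x * haj
    rw [this]
    exact neg_mem hax

/-- An injective envelope of `k/𝔯` cogenerates the category of `k`-modules. -/
theorem IsInjectiveEnvelopeOfResidueField.exists_apply_ne_zero [IsArtinianRing k]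
    (hE : IsInjectiveEnvelopeOfResidueField k E) {M : Type v} [AddCommGroup M] [Module k M]
    {x : M} (hx : x ≠ 0) : ∃ f : M →ₗ[k] E, f x ≠ 0 := by
  let τ := LinearMap.toSpanSingleton k M x
  have hτ : LinearMap.ker τ ≠ ⊤ := fun h => hx (by
    have : (1 : k) ∈ LinearMap.ker τ := h ▸ Submodule.mem_top
    simpa [τ] using this)
  obtain ⟨m, hm, hle⟩ := Ideal.exists_le_maximal (LinearMap.ker τ) hτ
  obtain ⟨t, ht, htm, -⟩ := hE.exists_torsion_generator m
  obtain ⟨f, hf⟩ := hE.1.out ((LinearMap.ker τ).liftQ τ le_rfl)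
    (LinearMap.ker_eq_bot.1 (Submodule.ker_liftQ_eq_bot _ _ _ le_rfl))
    ((LinearMap.ker τ).liftQ (LinearMap.toSpanSingleton k E t)
      fun c hc => by simpa using htm c (hle hc))
  refine ⟨f, ?_⟩
  have := hf (Submodule.Quotient.mk 1)
  simp only [Submodule.liftQ_apply, LinearMap.toSpanSingleton_apply, one_smul, τ] at this
  rwa [this]

theorem IsInjectiveEnvelopeOfResidueField.length_dual_simple_le [IsArtinianRing k]
    (hE : IsInjectiveEnvelopeOfResidueField k E) (S : Type v) [AddCommGroup S] [Module k S]
    [IsSimpleModule k S] : Module.length k (S →ₗ[k] E) ≤ 1 := by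
  have := IsSimpleModule.nontrivial k S
  obtain ⟨s, hs⟩ := exists_ne (0 : S)
  let σ := LinearMap.toSpanSingleton k S s
  have hσ : Function.Surjective σ := IsSimpleModule.toSpanSingleton_surjective k hs
  have hm : Ideal.IsMaximal (LinearMap.ker σ) := IsSimpleModule.ker_toSpanSingleton_isMaximal k hs
  obtain ⟨t, -, htm, ht⟩ := hE.exists_torsion_generator (LinearMap.ker σ)
  let τ : (k ⧸ LinearMap.ker σ) →ₗ[k] E := (LinearMap.ker σ).liftQ
    (LinearMap.toSpanSingleton k E t) fun c hc => by simpa using htm c hc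
  let ev : (S →ₗ[k] E) →ₗ[k] LinearMap.range τ :=
    (LinearMap.applyₗ s).codRestrict _ fun f => by
      obtain ⟨x, hx⟩ := ht (f s) fun a ha => by
        rw [← map_smul]
        have : a • s = 0 := by simpa [σ] using ha
        rw [this, map_zero]
      exact ⟨Submodule.Quotient.mk x, hx⟩
  have hev : Function.Injective ev := by
    intro f g hfg
    have h : f s = g s := congrArg Subtype.val hfg
    ext y
    obtain ⟨c, rfl⟩ := hσ y
    simp [σ, h]
  have hsimple : IsSimpleModule k (k ⧸ LinearMap.ker σ) :=
    isSimpleModule_iff_isCoatom.2 hm.out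
  calc Module.length k (S →ₗ[k] E) ≤ Module.length k (LinearMap.range τ) :=
        Module.length_le_of_injective ev hev
    _ ≤ Module.length k (k ⧸ LinearMap.ker σ) :=
        Module.length_le_of_surjective τ.rangeRestrict τ.surjective_rangeRestrict
    _ = 1 := Module.length_eq_one k _

theorem IsInjectiveEnvelopeOfResidueField.length_dual_le [IsArtinianRing k]
    (hE : IsInjectiveEnvelopeOfResidueField k E) {M : Type v} [AddCommGroup M] [Module k M]
    (hM : IsFiniteLength k M) : Module.length k (M →ₗ[k] E) ≤ Module.length k M := by
  induction hM with
  | of_subsingleton => rw [Module.length_eq_zero_iff.2 inferInstance]; exact zero_le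
  | @of_simple_quotient M _ _ N _ _ ih =>
    have hexact : Function.Exact (LinearMap.lcomp k E N.mkQ) (LinearMap.lcomp k E N.subtype) := by
      intro f
      constructor
      · intro hf
        refine ⟨N.liftQ f fun x hx => ?_, ?_⟩
        · exact LinearMap.congr_fun hf ⟨x, hx⟩
        · ext x; rfl
      · rintro ⟨g, rfl⟩
        ext x
        change g (Submodule.Quotient.mk x) = 0
        rw [(Submodule.Quotient.mk_eq_zero N).2 x.2, map_zero]
    rw [Module.length_eq_add_of_exact _ _ (N.subtype_injective) (N.mkQ_surjective)
      (LinearMap.exact_subtype_mkQ N),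
      Module.length_eq_add_of_exact (LinearMap.lcomp k E N.mkQ) (LinearMap.lcomp k E N.subtype)
        ?_ ?_ hexact, add_comm, Module.length_eq_one k (M ⧸ N)]
    · exact add_le_add ih (hE.length_dual_simple_le _)
    · intro f g hfg
      ext x
      exact LinearMap.congr_fun hfg x
    · intro g
      obtain ⟨f, hf⟩ := hE.1.out N.subtype N.subtype_injective g
      exact ⟨f, LinearMap.ext hf⟩

/-- Modules of finite length are reflexive for the duality `Hom_k(-, E)`. -/
theorem IsInjectiveEnvelopeOfResidueField.bijective_eval [IsArtinianRing k]
    (hE : IsInjectiveEnvelopeOfResidueField k E) {M : Type v} [AddCommGroup M] [Module k M]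
    (hM : IsFiniteLength k M) :
    Function.Bijective (LinearMap.applyₗ : M →ₗ[k] (M →ₗ[k] E) →ₗ[k] E) := by
  have hinj : Function.Injective (LinearMap.applyₗ : M →ₗ[k] (M →ₗ[k] E) →ₗ[k] E) := by
    rw [injective_iff_map_eq_zero]
    intro x hx
    by_contra hx0
    obtain ⟨f, hf⟩ := hE.exists_apply_ne_zero hx0
    exact hf (LinearMap.congr_fun hx f)
  have hfin : IsFiniteLength k (M →ₗ[k] E) := Module.length_ne_top_iff.1
    ((hE.length_dual_le hM).trans_lt (Module.length_ne_top_iff.2 hM).lt_top).ne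
  have hle := (hE.length_dual_le hfin).trans (hE.length_dual_le hM)
  have hfin' : IsFiniteLength k ((M →ₗ[k] E) →ₗ[k] E) := Module.length_ne_top_iff.1
    (hle.trans_lt (Module.length_ne_top_iff.2 hM).lt_top).ne
  refine ⟨hinj, LinearMap.range_eq_top.1 ?_⟩
  by_contra hne
  obtain ⟨_, _⟩ := isFiniteLength_iff_isNoetherian_isArtinian.1 hfin'
  have hlt := Submodule.length_lt hne
  rw [← (LinearEquiv.ofInjective _ hinj).length_eq] at hlt
  exact absurd hle hlt.not_ge

end MatlisDuality

section Pointwise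

variable {k : Type v} [CommRing k] {J : Type u} [Category.{v} J]

theorem NatTrans.exists_of_exact_app {F G H : J ⥤ ModuleCat.{v} k} {α : F ⟶ G} {β : G ⟶ H}
    {w : α ≫ β = 0} (h : (ShortComplex.mk α β w).Exact) (A : J) (y : G.obj A)
    (hy : β.app A y = 0) : ∃ x, α.app A x = y :=
  (ShortComplex.moduleCat_exact_iff _).1 (h.map ((evaluation J (ModuleCat.{v} k)).obj A)) y hy

theorem NatTrans.cokernel_π_app_surjective {F G : J ⥤ ModuleCat.{v} k} (α : F ⟶ G) (A : J) :
    Function.Surjective ((cokernel.π α).app A) :=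
  (ModuleCat.epi_iff_surjective _).1 inferInstance

theorem NatTrans.app_app_eq_zero {F G H : J ⥤ ModuleCat.{v} k} {α : F ⟶ G} {β : G ⟶ H}
    (w : α ≫ β = 0) (A : J) (x : F.obj A) : β.app A (α.app A x) = 0 :=
  congrArg (fun γ : F ⟶ H => γ.app A x) w

theorem NatTrans.exists_of_cokernel_π_app_eq_zero {F G : J ⥤ ModuleCat.{v} k} (α : F ⟶ G) (A : J)
    (y : G.obj A) (hy : (cokernel.π α).app A y = 0) : ∃ x, α.app A x = y :=
  NatTrans.exists_of_exact_app (ShortComplex.exact_cokernel α) A y hy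

theorem NatTrans.kernel_ι_app_injective {F G : J ⥤ ModuleCat.{v} k} (α : F ⟶ G) (A : J) :
    Function.Injective ((kernel.ι α).app A) :=
  (ModuleCat.mono_iff_injective _).1 inferInstance

theorem NatTrans.exists_of_app_eq_zero {F G : J ⥤ ModuleCat.{v} k} (α : F ⟶ G) (A : J)
    (y : F.obj A) (hy : α.app A y = 0) : ∃ x, (kernel.ι α).app A x = y :=
  NatTrans.exists_of_exact_app (ShortComplex.exact_kernel α) A y hy

end Pointwise

section FinitelyPresented

variable {k : Type v} [CommRing k] {C : Type u} [Category.{v} C] [Preadditive C] [Linear k C]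

/-- A linear functor with a generator `x ∈ G(X)` whose relations are generated by a single
morphism `p : X ⟶ Y`. -/
structure IsElementwiseFP (G : C ⥤ ModuleCat.{v} k) : Prop where
  map_add_apply : ∀ {A B : C} (f g : A ⟶ B) (x : G.obj A), G.map (f + g) x = G.map f x + G.map g x
  map_smul_apply : ∀ {A B : C} (r : k) (f : A ⟶ B) (x : G.obj A), G.map (r • f) x = r • G.map f x
  exists_presentation : ∃ (X Y : C) (p : X ⟶ Y) (x : G.obj X), G.map p x = 0 ∧
    (∀ (A : C) (g : G.obj A), ∃ f : X ⟶ A, G.map f x = g) ∧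
    ∀ (A : C) (f : X ⟶ A), G.map f x = 0 → ∃ t : Y ⟶ A, p ≫ t = f

/-- The natural transformation `Hom_C(X, -) ⟶ G` corresponding to `x ∈ G(X)`. -/
noncomputable def IsElementwiseFP.homOfElement {G : C ⥤ ModuleCat.{v} k} (hG : IsElementwiseFP G)
    {X : C} (x : G.obj X) : (linearCoyoneda k C).obj (op X) ⟶ G where
  app A := ModuleCat.ofHom
    { toFun := fun f : X ⟶ A => G.map f x
      map_add' := fun f g => hG.map_add_apply f g x
      map_smul' := fun r f => hG.map_smul_apply r f x }
  naturality A B f := by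
    refine ModuleCat.hom_ext (LinearMap.ext fun (g : X ⟶ A) => ?_)
    change G.map (g ≫ f) x = G.map f (G.map g x)
    simp

/-- A pointwise exact sequence `F ⟶ G ⟶ H ⟶ 0` of functors exhibits `H` as a cokernel. -/
theorem NatTrans.nonempty_iso_cokernel {J : Type u} [Category.{v} J]
    {F G H : J ⥤ ModuleCat.{v} k} (α : F ⟶ G) (β : G ⟶ H) (w : α ≫ β = 0)
    (hsurj : ∀ A, Function.Surjective (β.app A))
    (hex : ∀ A y, β.app A y = 0 → ∃ x, α.app A x = y) : Nonempty (H ≅ cokernel α) := by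
  have h (A : J) (y : G.obj A) :
      (cokernel.desc α β w).app A ((cokernel.π α).app A y) = β.app A y :=
    congrArg (fun γ : G ⟶ H => γ.app A y) (cokernel.π_desc α β w)
  have : ∀ A, IsIso ((cokernel.desc α β w).app A) := by
    intro A
    rw [ConcreteCategory.isIso_iff_bijective]
    constructor
    · refine (injective_iff_map_eq_zero ((cokernel.desc α β w).app A).hom).2 fun z hz => ?_
      obtain ⟨y, rfl⟩ := NatTrans.cokernel_π_app_surjective α A z
      obtain ⟨x, rfl⟩ := hex A y ((h A y).symm.trans hz)
      exact NatTrans.app_app_eq_zero (cokernel.condition α) A x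
    · intro z
      obtain ⟨y, rfl⟩ := hsurj A z
      exact ⟨_, h A y⟩
  have : IsIso (cokernel.desc α β w) := NatIso.isIso_of_isIso_app _
  exact ⟨(asIso (cokernel.desc α β w)).symm⟩

theorem IsElementwiseFP.isFPCov {G : C ⥤ ModuleCat.{v} k} (hG : IsElementwiseFP G) :
    IsFPCov k C G := by
  obtain ⟨X, Y, p, x, hpx, hgen, hrel⟩ := hG.exists_presentation
  refine ⟨X, Y, p, NatTrans.nonempty_iso_cokernel _ (hG.homOfElement x) ?_ hgen hrel⟩
  ext A : 2
  refine ModuleCat.hom_ext (LinearMap.ext fun (f : Y ⟶ A) => ?_)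
  change G.map (p ≫ f) x = 0
  simp [hpx]

theorem IsElementwiseFP.of_iso_cokernel {X Y : C} (p : X ⟶ Y) {G : C ⥤ ModuleCat.{v} k}
    (e : G ≅ cokernel ((linearCoyoneda k C).map p.op)) : IsElementwiseFP G := by
  let π : (linearCoyoneda k C).obj (op X) ⟶ G := cokernel.π _ ≫ e.inv
  have hsurj (A : C) : ∀ x : G.obj A, ∃ h : X ⟶ A, π.app A h = x :=
    (ModuleCat.epi_iff_surjective (π.app A)).1 inferInstance
  have hex (A : C) (f : X ⟶ A) (hf : π.app A f = 0) : ∃ t : Y ⟶ A, p ≫ t = f := by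
    refine NatTrans.exists_of_cokernel_π_app_eq_zero ((linearCoyoneda k C).map p.op) A f ?_
    have := congrArg (e.hom.app A) hf
    rw [map_zero] at this
    rw [← this]
    exact congrArg (fun γ : (linearCoyoneda k C).obj (op X) ⟶ _ => γ.app A f)
      (show cokernel.π _ = π ≫ e.hom by simp [π])
  have hπ {A B : C} (f : A ⟶ B) (g : X ⟶ A) : G.map f (π.app A g) = π.app B (g ≫ f) :=
    (NatTrans.naturality_apply π f g).symm
  refine ⟨?_, ?_, X, Y, p, π.app X (𝟙 X), ?_, ?_, ?_⟩
  · intro A B f g x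
    obtain ⟨h, rfl⟩ := hsurj A x
    rw [hπ, hπ, hπ, Preadditive.comp_add]
    exact (π.app B).hom.map_add (_ : X ⟶ B) _
  · intro A B r f x
    obtain ⟨h, rfl⟩ := hsurj A x
    rw [hπ, hπ, Linear.comp_smul]
    exact (π.app B).hom.map_smul r (_ : X ⟶ B)
  · rw [hπ, Category.id_comp]
    have h := NatTrans.app_app_eq_zero (show (linearCoyoneda k C).map p.op ≫ π = 0 by simp [π]) Y
      (𝟙 Y)
    change π.app Y (p ≫ 𝟙 Y) = 0 at h
    rwa [Category.comp_id] at h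
  · intro A g
    obtain ⟨f, rfl⟩ := hsurj A g
    exact ⟨f, by rw [hπ, Category.id_comp]⟩
  · intro A f hf
    rw [hπ, Category.id_comp] at hf
    exact hex A f hf

theorem isFPCov_iff {G : C ⥤ ModuleCat.{v} k} : IsFPCov k C G ↔ IsElementwiseFP G :=
  ⟨fun ⟨_, _, p, ⟨e⟩⟩ => IsElementwiseFP.of_iso_cokernel p e, fun h => h.isFPCov⟩

theorem IsElementwiseFP.of_surjective_of_exact [HasBinaryBiproducts C]
    {G₁ G₂ H : C ⥤ ModuleCat.{v} k}
    (h₁ : IsElementwiseFP G₁) (h₂ : IsElementwiseFP G₂) (α : G₁ ⟶ G₂) (β : G₂ ⟶ H)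
    (w : ∀ A x, β.app A (α.app A x) = 0) (hsurj : ∀ A, Function.Surjective (β.app A))
    (hex : ∀ A y, β.app A y = 0 → ∃ x, α.app A x = y) : IsElementwiseFP H := by
  obtain ⟨X₁, Y₁, p₁, x₁, -, hgen₁, -⟩ := h₁.exists_presentation
  obtain ⟨X₂, Y₂, p₂, x₂, hpx₂, hgen₂, hrel₂⟩ := h₂.exists_presentation
  have hβ {A B : C} (f : A ⟶ B) (x : G₂.obj A) : H.map f (β.app A x) = β.app B (G₂.map f x) :=
    (NatTrans.naturality_apply β f x).symm
  obtain ⟨q, hq⟩ := hgen₂ X₁ (α.app X₁ x₁)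
  refine ⟨?_, ?_, X₂, Y₂ ⊞ X₁, biprod.lift p₂ q, β.app X₂ x₂, ?_, ?_, ?_⟩
  · intro A B f g x
    obtain ⟨y, rfl⟩ := hsurj A x
    rw [hβ, hβ, hβ, h₂.map_add_apply, map_add]
  · intro A B r f x
    obtain ⟨y, rfl⟩ := hsurj A x
    rw [hβ, hβ, h₂.map_smul_apply, map_smul]
  · have : biprod.lift p₂ q = p₂ ≫ biprod.inl + q ≫ biprod.inr := by ext <;> simp
    rw [hβ, this, h₂.map_add_apply, G₂.map_comp, G₂.map_comp, ModuleCat.comp_apply,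
      ModuleCat.comp_apply, hpx₂, hq, map_zero, zero_add, ← hβ, w, map_zero]
  · intro A g
    obtain ⟨y, rfl⟩ := hsurj A g
    obtain ⟨f, rfl⟩ := hgen₂ A y
    exact ⟨f, hβ f x₂⟩
  · intro A f hf
    rw [hβ] at hf
    obtain ⟨y, hy⟩ := hex A _ hf
    obtain ⟨h, rfl⟩ := hgen₁ A y
    have hzero : G₂.map (f + (-1 : k) • (q ≫ h)) x₂ = 0 := by
      rw [h₂.map_add_apply, h₂.map_smul_apply, G₂.map_comp, ModuleCat.comp_apply, hq, ← hy,
        NatTrans.naturality_apply α h x₁]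
      simp
    obtain ⟨t, ht⟩ := hrel₂ A _ hzero
    refine ⟨biprod.desc t h, ?_⟩
    rw [biprod.lift_desc, ht]
    simp

/-- Weak cokernels and biproducts yield weak pushouts. -/
theorem HasWeakCokernels.exists_weakPushout [HasBinaryBiproducts C] (hC : HasWeakCokernels C)
    {X Y Z : C} (f : X ⟶ Y) (g : X ⟶ Z) :
    ∃ (W : C) (u : Y ⟶ W) (v : Z ⟶ W), f ≫ u = g ≫ v ∧
      ∀ (A : C) (s : Y ⟶ A) (t : Z ⟶ A), f ≫ s = g ≫ t →
        ∃ w : W ⟶ A, u ≫ w = s ∧ v ≫ w = t := by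
  obtain ⟨W, c, hc, hu⟩ := hC (biprod.lift f (-g))
  refine ⟨W, biprod.inl ≫ c, biprod.inr ≫ c, ?_, ?_⟩
  · have : biprod.lift f (-g) = f ≫ biprod.inl - g ≫ biprod.inr := by ext <;> simp
    rw [this, Preadditive.sub_comp, sub_eq_zero] at hc
    simpa using hc
  · intro A s t hst
    obtain ⟨w, hw⟩ := hu (biprod.desc s t) (by simp [biprod.lift_desc, hst])
    exact ⟨w, by simp [hw], by simp [hw]⟩

theorem IsElementwiseFP.of_injective_of_exact [HasBinaryBiproducts C] (hC : HasWeakCokernels C)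
    {K G₁ G₂ : C ⥤ ModuleCat.{v} k}
    (h₁ : IsElementwiseFP G₁) (h₂ : IsElementwiseFP G₂) (ι : K ⟶ G₁) (α : G₁ ⟶ G₂)
    (w : ∀ A x, α.app A (ι.app A x) = 0) (hinj : ∀ A, Function.Injective (ι.app A))
    (hex : ∀ A y, α.app A y = 0 → ∃ x, ι.app A x = y) : IsElementwiseFP K := by
  obtain ⟨X₁, Y₁, p₁, x₁, hpx₁, hgen₁, hrel₁⟩ := h₁.exists_presentation
  obtain ⟨X₂, Y₂, p₂, x₂, hpx₂, hgen₂, hrel₂⟩ := h₂.exists_presentation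
  have hι {A B : C} (f : A ⟶ B) (x : K.obj A) : ι.app B (K.map f x) = G₁.map f (ι.app A x) :=
    NatTrans.naturality_apply ι f x
  have hα {A B : C} (f : A ⟶ B) (x : G₁.obj A) : α.app B (G₁.map f x) = G₂.map f (α.app A x) :=
    NatTrans.naturality_apply α f x
  have hc₁ {A B : C} (f : X₁ ⟶ A) (g : A ⟶ B) : G₁.map g (G₁.map f x₁) = G₁.map (f ≫ g) x₁ := by
    simp
  have hc₂ {A B : C} (f : X₂ ⟶ A) (g : A ⟶ B) : G₂.map g (G₂.map f x₂) = G₂.map (f ≫ g) x₂ := by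
    simp
  obtain ⟨q, hq⟩ := hgen₂ X₁ (α.app X₁ x₁)
  obtain ⟨Z, u, v, huv, hZ⟩ := hC.exists_weakPushout q p₂
  obtain ⟨W, a, b, hab, hW⟩ := hC.exists_weakPushout u p₁
  obtain ⟨z, hz⟩ := hex Z (G₁.map u x₁) (by
    rw [hα, ← hq, hc₂, huv, ← hc₂, hpx₂, map_zero])
  refine ⟨?_, ?_, Z, W, a, z, ?_, ?_, ?_⟩
  · intro A B f g x
    apply hinj
    rw [map_add, hι, hι, hι, h₁.map_add_apply]
  · intro A B r f x
    apply hinj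
    rw [map_smul, hι, hι, h₁.map_smul_apply]
  · apply hinj
    rw [hι, hz, hc₁, hab, ← hc₁, hpx₁, map_zero, map_zero]
  · intro A g
    obtain ⟨f, hf⟩ := hgen₁ A (ι.app A g)
    have h0 : G₂.map (q ≫ f) x₂ = 0 := by rw [← hc₂, hq, ← hα, hf, w]
    obtain ⟨t, ht⟩ := hrel₂ A _ h0
    obtain ⟨s, hs, -⟩ := hZ A f t ht.symm
    refine ⟨s, hinj A ?_⟩
    rw [hι, hz, hc₁, hs, hf]
  · intro A f hf
    have h0 : G₁.map (u ≫ f) x₁ = 0 := by rw [← hc₁, ← hz, ← hι, hf, map_zero]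
    obtain ⟨s, hs⟩ := hrel₁ A _ h0
    obtain ⟨t, ht, -⟩ := hW A f s hs.symm
    exact ⟨t, ht⟩

end FinitelyPresented

section Opposite

variable {k : Type v} [CommRing k] {C : Type u} [Category.{v} C] [Preadditive C] [Linear k C]

/-- The opposite of a linear category is linear. -/
instance CategoryTheory.Linear.instOpposite : Linear k Cᵒᵖ where
  homModule X Y := Equiv.module k (opEquiv X Y)
  smul_comp _ _ _ r f g := Quiver.Hom.unop_inj (Linear.comp_smul _ _ _ g.unop r f.unop)
  comp_smul _ _ _ f r g := Quiver.Hom.unop_inj (Linear.smul_comp _ _ _ r g.unop f.unop)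

/-- Passing to the opposite category, as a linear equivalence of `Hom`-modules. -/
def CategoryTheory.Linear.opLinearEquiv (A : Cᵒᵖ) (Y : C) :
    (A.unop ⟶ Y) ≃ₗ[k] (op Y ⟶ A) where
  toFun f := f.op
  invFun f := f.unop
  map_add' _ _ := rfl
  map_smul' _ _ := rfl

/-- Representable presheaves on `C` are corepresentable functors on `Cᵒᵖ`. -/
def linearYonedaIsoOp (Y : C) :
    (linearYoneda k C).obj Y ≅ (linearCoyoneda k Cᵒᵖ).obj (op (op Y)) :=
  NatIso.ofComponents (fun A => (Linear.opLinearEquiv A Y).toModuleIso) (fun _ => rfl)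

theorem isFPContra_iff_isFPCov_op {F : Cᵒᵖ ⥤ ModuleCat.{v} k} :
    IsFPContra k C F ↔ IsFPCov k Cᵒᵖ F := by
  have key {X Y : C} (p : X ⟶ Y) : cokernel ((linearYoneda k C).map p) ≅
      cokernel ((linearCoyoneda k Cᵒᵖ).map p.op.op) :=
    cokernel.mapIso _ _ (linearYonedaIsoOp X) (linearYonedaIsoOp Y) rfl
  constructor
  · rintro ⟨X, Y, p, ⟨e⟩⟩
    exact ⟨op Y, op X, p.op, ⟨e ≪≫ key p⟩⟩
  · rintro ⟨X, Y, p, ⟨e⟩⟩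
    exact ⟨Y.unop, X.unop, p.unop, ⟨e ≪≫ (key p.unop).symm⟩⟩

theorem isFPContra_iff {F : Cᵒᵖ ⥤ ModuleCat.{v} k} : IsFPContra k C F ↔ IsElementwiseFP F :=
  isFPContra_iff_isFPCov_op.trans isFPCov_iff

theorem HasWeakKernels.op (hC : _root_.HasWeakKernels C) : HasWeakCokernels Cᵒᵖ := by
  intro X Y f
  obtain ⟨Z, g, hg, hu⟩ := hC f.unop
  refine ⟨Opposite.op Z, g.op, Quiver.Hom.unop_inj hg, fun A h hh => ?_⟩
  obtain ⟨t, ht⟩ := hu h.unop (congrArg Quiver.Hom.unop hh)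
  exact ⟨t.op, Quiver.Hom.unop_inj ht⟩

theorem IsFPCov.of_iso {F G : C ⥤ ModuleCat.{v} k} (e : F ≅ G) (h : IsFPCov k C G) :
    IsFPCov k C F := by
  obtain ⟨X, Y, p, ⟨e'⟩⟩ := h
  exact ⟨X, Y, p, ⟨e ≪≫ e'⟩⟩

theorem IsFPContra.of_iso {F G : Cᵒᵖ ⥤ ModuleCat.{v} k} (e : F ≅ G) (h : IsFPContra k C G) :
    IsFPContra k C F := by
  obtain ⟨X, Y, p, ⟨e'⟩⟩ := h
  exact ⟨X, Y, p, ⟨e ≪≫ e'⟩⟩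

theorem isFPCov_linearCoyoneda (c : C) :
    IsFPCov k C ((linearCoyoneda k C).obj (op c)) :=
  ⟨c, c, 0, NatTrans.nonempty_iso_cokernel _ (𝟙 _)
    (by
      ext A : 2
      refine ModuleCat.hom_ext (LinearMap.ext fun (f : c ⟶ A) => ?_)
      exact (zero_comp : (0 : c ⟶ c) ≫ f = 0))
    (fun _ y => ⟨y, rfl⟩)
    (fun A y hy => ⟨0, (map_zero (((linearCoyoneda k C).map (0 : c ⟶ c).op).app A).hom).trans
      hy.symm⟩)⟩

theorem isFPContra_linearYoneda (c : C) :
    IsFPContra k C ((linearYoneda k C).obj c) :=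
  ⟨c, c, 0, NatTrans.nonempty_iso_cokernel _ (𝟙 _)
    (by
      ext A : 2
      refine ModuleCat.hom_ext (LinearMap.ext fun (f : A.unop ⟶ c) => ?_)
      exact (comp_zero : f ≫ (0 : c ⟶ c) = 0))
    (fun _ y => ⟨y, rfl⟩)
    (fun A y hy => ⟨0, (map_zero (((linearYoneda k C).map (0 : c ⟶ c)).app A).hom).trans
      hy.symm⟩)⟩

theorem IsElementwiseFP.isFiniteLength_obj {G : C ⥤ ModuleCat.{v} k} (hG : IsElementwiseFP G)
    (homFinite : ∀ A B : C, IsFiniteLength k (A ⟶ B)) (A : C) : IsFiniteLength k (G.obj A) := by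
  obtain ⟨X, -, -, x, -, hgen, -⟩ := hG.exists_presentation
  exact (homFinite X A).of_surjective (f := ((hG.homOfElement x).app A).hom) (hgen A)

theorem isFiniteLength_hom_op (homFinite : ∀ A B : C, IsFiniteLength k (A ⟶ B)) (A B : Cᵒᵖ) :
    IsFiniteLength k (A ⟶ B) :=
  (Linear.opLinearEquiv (k := k) B A.unop).isFiniteLength (homFinite _ _)

/-- If the kernel of `Hom_C(Y, -) ⟶ Hom_C(X, -)` is finitely presented, then `X ⟶ Y` has a weak
cokernel. -/
theorem exists_isWeakCokernel_of_isFPCov_kernel {X Y : C} (f : X ⟶ Y)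
    (h : IsFPCov k C (kernel ((linearCoyoneda k C).map f.op))) :
    ∃ (Z : C) (g : Y ⟶ Z), IsWeakCokernel f g := by
  obtain ⟨Z, -, -, z, -, hgen, -⟩ := (isFPCov_iff.1 h).exists_presentation
  let φ := (linearCoyoneda k C).map f.op
  refine ⟨Z, (kernel.ι φ).app Z z, NatTrans.app_app_eq_zero (kernel.condition φ) Z z, ?_⟩
  intro A h hh
  obtain ⟨y, hy⟩ := NatTrans.exists_of_app_eq_zero φ A h hh
  obtain ⟨t, rfl⟩ := hgen A y
  exact ⟨t, (NatTrans.naturality_apply (kernel.ι φ) t z).symm.trans hy⟩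

theorem exists_isWeakKernel_of_isFPContra_kernel {Y Z : C} (g : Y ⟶ Z)
    (h : IsFPContra k C (kernel ((linearYoneda k C).map g))) :
    ∃ (X : C) (f : X ⟶ Y), IsWeakKernel f g := by
  obtain ⟨X, -, -, z, -, hgen, -⟩ := (isFPContra_iff.1 h).exists_presentation
  let φ := (linearYoneda k C).map g
  refine ⟨X.unop, (kernel.ι φ).app X z, NatTrans.app_app_eq_zero (kernel.condition φ) X z, ?_⟩
  intro A h hh
  obtain ⟨y, hy⟩ := NatTrans.exists_of_app_eq_zero φ (op A) h hh
  obtain ⟨t, rfl⟩ := hgen (op A) y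
  exact ⟨t.unop, (NatTrans.naturality_apply (kernel.ι φ) t z).symm.trans hy⟩

end Opposite

section Duality

variable {k : Type v} [CommRing k] {E : Type v} [AddCommGroup E] [Module k E]

theorem NatTrans.exists_app_comp_eq_of_exact [Injective (ModuleCat.of k E)]
    {J : Type u} [Category.{v} J] {F G H : J ⥤ ModuleCat.{v} k} {α : F ⟶ G} {β : G ⟶ H}
    {w : α ≫ β = 0} (h : (ShortComplex.mk α β w).Exact) (A : J)
    (φ : G.obj A ⟶ ModuleCat.of k E) (hφ : α.app A ≫ φ = 0) :
    ∃ ψ : H.obj A ⟶ ModuleCat.of k E, β.app A ≫ ψ = φ :=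
  ⟨_, (h.map ((evaluation J (ModuleCat.{v} k)).obj A)).comp_descToInjective φ hφ⟩

/-- The evaluation `M ⟶ D D M`. -/
noncomputable def evalHom (E : Type v) [AddCommGroup E] [Module k E] (M : ModuleCat.{v} k) :
    M ⟶ (DModule k E).obj (op ((DModule k E).obj (op M))) :=
  ModuleCat.ofHom
    { toFun := fun x => ModuleCat.ofHom
        { toFun := fun φ : M ⟶ ModuleCat.of k E => φ x
          map_add' := fun _ _ => rfl
          map_smul' := fun _ _ => rfl }
      map_add' := fun x y => by
        refine ModuleCat.hom_ext (LinearMap.ext fun (φ : M ⟶ ModuleCat.of k E) => ?_)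
        exact φ.hom.map_add x y
      map_smul' := fun r x => by
        refine ModuleCat.hom_ext (LinearMap.ext fun (φ : M ⟶ ModuleCat.of k E) => ?_)
        exact φ.hom.map_smul r x }

theorem IsInjectiveEnvelopeOfResidueField.isIso_evalHom [IsArtinianRing k]
    (hE : IsInjectiveEnvelopeOfResidueField k E) (M : ModuleCat.{v} k)
    (hM : IsFiniteLength k M) : IsIso (evalHom E M) := by
  obtain ⟨hinj, hsurj⟩ := hE.bijective_eval hM
  rw [ConcreteCategory.isIso_iff_bijective]
  constructor
  · intro x y hxy
    refine hinj (LinearMap.ext fun f => ?_)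
    exact congrArg (fun Ψ : ModuleCat.of k (M ⟶ ModuleCat.of k E) ⟶ ModuleCat.of k E =>
      Ψ (ModuleCat.ofHom f)) hxy
  · intro Ψ
    obtain ⟨x, hx⟩ := hsurj (ModuleCat.Hom.hom Ψ ∘ₗ
      (ModuleCat.homLinearEquiv (S := k) (M := M) (N := ModuleCat.of k E)).symm.toLinearMap)
    refine ⟨x, ModuleCat.hom_ext (LinearMap.ext fun (φ : M ⟶ ModuleCat.of k E) => ?_)⟩
    exact LinearMap.congr_fun hx φ.hom

variable {C : Type u} [Category.{v} C]

/-- The evaluation transformation `F ⟶ D D F` for presheaves. -/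
noncomputable def evalContra (E : Type v) [AddCommGroup E] [Module k E]
    (F : Cᵒᵖ ⥤ ModuleCat.{v} k) :
    F ⟶ (dualizeCov k E C).obj (op ((dualizeContra k E C).obj (op F))) where
  app A := evalHom E (F.obj A)
  naturality _ _ _ := rfl

/-- The evaluation transformation `G ⟶ D D G` for copresheaves. -/
noncomputable def evalCov (E : Type v) [AddCommGroup E] [Module k E]
    (G : C ⥤ ModuleCat.{v} k) :
    G ⟶ (dualizeContra k E C).obj (op ((dualizeCov k E C).obj (op G))) where
  app A := evalHom E (G.obj A)
  naturality _ _ _ := rfl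

theorem IsInjectiveEnvelopeOfResidueField.isIso_evalContra [IsArtinianRing k]
    (hE : IsInjectiveEnvelopeOfResidueField k E) (F : Cᵒᵖ ⥤ ModuleCat.{v} k)
    (hF : ∀ A, IsFiniteLength k (F.obj A)) : IsIso (evalContra E F) := by
  have (A : Cᵒᵖ) : IsIso ((evalContra E F).app A) := hE.isIso_evalHom _ (hF A)
  exact NatIso.isIso_of_isIso_app _

theorem IsInjectiveEnvelopeOfResidueField.isIso_evalCov [IsArtinianRing k]
    (hE : IsInjectiveEnvelopeOfResidueField k E) (G : C ⥤ ModuleCat.{v} k)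
    (hG : ∀ A, IsFiniteLength k (G.obj A)) : IsIso (evalCov E G) := by
  have (A : C) : IsIso ((evalCov E G).app A) := hE.isIso_evalHom _ (hG A)
  exact NatIso.isIso_of_isIso_app _

theorem IsInjectiveEnvelopeOfResidueField.dualizeContra_map_injective [IsArtinianRing k]
    (hE : IsInjectiveEnvelopeOfResidueField k E) {F₁ F₂ : Cᵒᵖ ⥤ ModuleCat.{v} k}
    {α β : F₁ ⟶ F₂} (h : (dualizeContra k E C).map α.op = (dualizeContra k E C).map β.op) :
    α = β := by
  ext A : 2
  refine ModuleCat.hom_ext (LinearMap.ext fun x => ?_)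
  by_contra hne
  obtain ⟨f, hf⟩ := hE.exists_apply_ne_zero (sub_ne_zero.2 hne)
  apply hf
  rw [map_sub, sub_eq_zero]
  have h' : α.app A ≫ ModuleCat.ofHom f = β.app A ≫ ModuleCat.ofHom f :=
    congrArg (fun γ : (dualizeContra k E C).obj (op F₂) ⟶ (dualizeContra k E C).obj (op F₁) =>
      γ.app A.unop (ModuleCat.ofHom f : F₂.obj A ⟶ ModuleCat.of k E)) h
  exact congrArg (fun g : F₁.obj A ⟶ ModuleCat.of k E => g x) h'

theorem IsInjectiveEnvelopeOfResidueField.dualizeContra_map_surjective [IsArtinianRing k]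
    (hE : IsInjectiveEnvelopeOfResidueField k E) {F₁ F₂ : Cᵒᵖ ⥤ ModuleCat.{v} k}
    (hF₂ : ∀ A, IsFiniteLength k (F₂.obj A))
    (γ : (dualizeContra k E C).obj (op F₂) ⟶ (dualizeContra k E C).obj (op F₁)) :
    ∃ α : F₁ ⟶ F₂, (dualizeContra k E C).map α.op = γ := by
  have := hE.isIso_evalContra F₂ hF₂
  let α : F₁ ⟶ F₂ := evalContra E F₁ ≫ (dualizeCov k E C).map γ.op ≫ inv (evalContra E F₂)
  have hα : α ≫ evalContra E F₂ = evalContra E F₁ ≫ (dualizeCov k E C).map γ.op := by simp [α]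
  refine ⟨α, ?_⟩
  ext A : 2
  refine ModuleCat.hom_ext (LinearMap.ext fun (φ : F₂.obj (op A) ⟶ ModuleCat.of k E) => ?_)
  refine ModuleCat.hom_ext (LinearMap.ext fun (x : F₁.obj (op A)) => ?_)
  have h := congrArg (fun δ : F₁ ⟶ (dualizeCov k E C).obj (op ((dualizeContra k E C).obj (op F₂)))
    => δ.app (op A) x) hα
  exact congrArg (fun Ψ : ModuleCat.of k (F₂.obj (op A) ⟶ ModuleCat.of k E) ⟶ ModuleCat.of k E =>
    Ψ φ) h

variable [Preadditive C] [Linear k C] [HasBinaryBiproducts C]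

theorem isFPCov_dualizeContra_of_isFPContra [Injective (ModuleCat.of k E)]
    (hC : HasWeakCokernels C)
    (hrep : ∀ c : C, IsFPCov k C ((dualizeContra k E C).obj (op ((linearYoneda k C).obj c))))
    {F : Cᵒᵖ ⥤ ModuleCat.{v} k} (hF : IsFPContra k C F) :
    IsFPCov k C ((dualizeContra k E C).obj (op F)) := by
  obtain ⟨X, Y, p, ⟨e⟩⟩ := hF
  refine IsFPCov.of_iso ((dualizeContra k E C).mapIso e.symm.op) (isFPCov_iff.2 ?_)
  let φ := (linearYoneda k C).map p
  refine IsElementwiseFP.of_injective_of_exact hC (isFPCov_iff.1 (hrep Y)) (isFPCov_iff.1 (hrep X))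
    ((dualizeContra k E C).map (cokernel.π φ).op) ((dualizeContra k E C).map φ.op) ?_ ?_ ?_
  · intro A (ψ : (cokernel φ).obj (op A) ⟶ ModuleCat.of k E)
    change φ.app (op A) ≫ (cokernel.π φ).app (op A) ≫ ψ = 0
    rw [← Category.assoc, ← NatTrans.comp_app, cokernel.condition]
    exact zero_comp
  · intro A ψ ψ' h
    exact (cancel_epi ((cokernel.π φ).app (op A))).1 h
  · intro A ψ hψ
    exact NatTrans.exists_app_comp_eq_of_exact (ShortComplex.exact_cokernel φ) (op A) ψ hψ

theorem isFPContra_dualizeCov_of_isFPCov [Injective (ModuleCat.of k E)]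
    (hC : _root_.HasWeakKernels C)
    (hrep : ∀ c : C,
      IsFPContra k C ((dualizeCov k E C).obj (op ((linearCoyoneda k C).obj (op c)))))
    {G : C ⥤ ModuleCat.{v} k} (hG : IsFPCov k C G) :
    IsFPContra k C ((dualizeCov k E C).obj (op G)) := by
  obtain ⟨X, Y, p, ⟨e⟩⟩ := hG
  refine IsFPContra.of_iso ((dualizeCov k E C).mapIso e.symm.op) (isFPContra_iff.2 ?_)
  let φ := (linearCoyoneda k C).map p.op
  refine IsElementwiseFP.of_injective_of_exact hC.op (isFPContra_iff.1 (hrep X))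
    (isFPContra_iff.1 (hrep Y))
    ((dualizeCov k E C).map (cokernel.π φ).op) ((dualizeCov k E C).map φ.op) ?_ ?_ ?_
  · intro A (ψ : (cokernel φ).obj A.unop ⟶ ModuleCat.of k E)
    change φ.app A.unop ≫ (cokernel.π φ).app A.unop ≫ ψ = 0
    rw [← Category.assoc, ← NatTrans.comp_app, cokernel.condition]
    exact zero_comp
  · intro A ψ ψ' h
    exact (cancel_epi ((cokernel.π φ).app A.unop)).1 h
  · intro A ψ hψ
    exact NatTrans.exists_app_comp_eq_of_exact (ShortComplex.exact_cokernel φ) A.unop ψ hψ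

theorem isFPCov_dualizeContra_kernel [Injective (ModuleCat.of k E)]
    {F₁ F₂ : Cᵒᵖ ⥤ ModuleCat.{v} k} (α : F₁ ⟶ F₂)
    (h₁ : IsFPCov k C ((dualizeContra k E C).obj (op F₁)))
    (h₂ : IsFPCov k C ((dualizeContra k E C).obj (op F₂))) :
    IsFPCov k C ((dualizeContra k E C).obj (op (kernel α))) := by
  refine isFPCov_iff.2 (IsElementwiseFP.of_surjective_of_exact (isFPCov_iff.1 h₂)
    (isFPCov_iff.1 h₁) ((dualizeContra k E C).map α.op)
    ((dualizeContra k E C).map (kernel.ι α).op) ?_ ?_ ?_)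
  · intro A (ψ : F₂.obj (op A) ⟶ ModuleCat.of k E)
    change (kernel.ι α).app (op A) ≫ α.app (op A) ≫ ψ = 0
    rw [← Category.assoc, ← NatTrans.comp_app, kernel.condition]
    exact zero_comp
  · intro A (ψ : (kernel α).obj (op A) ⟶ ModuleCat.of k E)
    exact ⟨Injective.factorThru ψ ((kernel.ι α).app (op A)),
      Injective.comp_factorThru ψ ((kernel.ι α).app (op A))⟩
  · intro A ψ hψ
    exact NatTrans.exists_app_comp_eq_of_exact (ShortComplex.exact_kernel α) (op A) ψ hψ

theorem isFPContra_dualizeCov_kernel [Injective (ModuleCat.of k E)]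
    {G₁ G₂ : C ⥤ ModuleCat.{v} k} (α : G₁ ⟶ G₂)
    (h₁ : IsFPContra k C ((dualizeCov k E C).obj (op G₁)))
    (h₂ : IsFPContra k C ((dualizeCov k E C).obj (op G₂))) :
    IsFPContra k C ((dualizeCov k E C).obj (op (kernel α))) := by
  refine isFPContra_iff.2 (IsElementwiseFP.of_surjective_of_exact (isFPContra_iff.1 h₂)
    (isFPContra_iff.1 h₁) ((dualizeCov k E C).map α.op)
    ((dualizeCov k E C).map (kernel.ι α).op) ?_ ?_ ?_)
  · intro A (ψ : G₂.obj A.unop ⟶ ModuleCat.of k E)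
    change (kernel.ι α).app A.unop ≫ α.app A.unop ≫ ψ = 0
    rw [← Category.assoc, ← NatTrans.comp_app, kernel.condition]
    exact zero_comp
  · intro A (ψ : (kernel α).obj A.unop ⟶ ModuleCat.of k E)
    exact ⟨Injective.factorThru ψ ((kernel.ι α).app A.unop),
      Injective.comp_factorThru ψ ((kernel.ι α).app A.unop)⟩
  · intro A ψ hψ
    exact NatTrans.exists_app_comp_eq_of_exact (ShortComplex.exact_kernel α) A.unop ψ hψ

end Duality

/-- Lemma `le:dual`.  A `k`-linear Hom-finite essentially small idempotent
complete additive category `C` is a dualising `k`-variety if and only if (1) `C` has weak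
kernels and weak cokernels, and (2) for every object `c` the functors `D Hom_C(−, c)` and
`D Hom_C(c, −)` are finitely presented. -/
theorem stmt_6 {k : Type v} [CommRing k] [IsArtinianRing k]
    (E : Type v) [AddCommGroup E] [Module k E]
    (hE : IsInjectiveEnvelopeOfResidueField k E)
    {C : Type u} [Category.{v} C] [Preadditive C] [Linear k C] [HasFiniteBiproducts C]
    [EssentiallySmall.{v} C] [IsIdempotentComplete C]
    (homFinite : ∀ A B : C, IsFiniteLength k (A ⟶ B)) :
    IsDualisingVariety k E C ↔
      ((_root_.HasWeakKernels C ∧ HasWeakCokernels C) ∧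
        ∀ c : C,
          IsFPCov k C ((dualizeContra k E C).obj (op ((linearYoneda k C).obj c))) ∧
          IsFPContra k C ((dualizeCov k E C).obj (op ((linearCoyoneda k C).obj (op c))))) := by
  have : HasBinaryBiproducts C := hasBinaryBiproducts_of_finite_biproducts C
  have : Injective (ModuleCat.of k E) := Module.injective_object_of_injective_module (inj := hE.1)
  have finCov {G : C ⥤ ModuleCat.{v} k} (hG : IsFPCov k C G) (A : C) :
      IsFiniteLength k (G.obj A) := (isFPCov_iff.1 hG).isFiniteLength_obj homFinite A
  have finContra {F : Cᵒᵖ ⥤ ModuleCat.{v} k} (hF : IsFPContra k C F) (A : Cᵒᵖ) :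
      IsFiniteLength k (F.obj A) :=
    (isFPContra_iff.1 hF).isFiniteLength_obj (isFiniteLength_hom_op homFinite) A
  constructor
  · rintro ⟨h, hequiv⟩
    have hCov {F : Cᵒᵖ ⥤ ModuleCat.{v} k} (hF : IsFPContra k C F) :
        IsFPCov k C ((dualizeContra k E C).obj (op F)) := h ⟨F, hF⟩
    have hContra {G : C ⥤ ModuleCat.{v} k} (hG : IsFPCov k C G) :
        IsFPContra k C ((dualizeCov k E C).obj (op G)) := by
      obtain ⟨F, ⟨e⟩⟩ := hequiv.essSurj.mem_essImage ⟨G, hG⟩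
      have e' : (dualizeContra k E C).obj (op F.unop.obj) ≅ G :=
        (ObjectProperty.ι (IsFPCov k C)).mapIso e
      have := hE.isIso_evalContra F.unop.obj (finContra F.unop.property)
      exact IsFPContra.of_iso
        ((dualizeCov k E C).mapIso e'.op ≪≫ (asIso (evalContra E F.unop.obj)).symm)
        F.unop.property
    refine ⟨⟨fun Y Z g => ?_, fun X Y f => ?_⟩, fun c =>
      ⟨hCov (isFPContra_linearYoneda c), hContra (isFPCov_linearCoyoneda c)⟩⟩
    · refine exists_isWeakKernel_of_isFPContra_kernel (k := k) g ?_
      have := hE.isIso_evalContra (kernel ((linearYoneda k C).map g)) fun A =>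
        (homFinite A.unop Y).of_injective
          (f := ((kernel.ι ((linearYoneda k C).map g)).app A).hom)
          (NatTrans.kernel_ι_app_injective _ A)
      exact IsFPContra.of_iso (asIso (evalContra E _)) (hContra (isFPCov_dualizeContra_kernel _
        (hCov (isFPContra_linearYoneda Y)) (hCov (isFPContra_linearYoneda Z))))
    · refine exists_isWeakCokernel_of_isFPCov_kernel (k := k) f ?_
      have := hE.isIso_evalCov (kernel ((linearCoyoneda k C).map f.op)) fun A =>
        (homFinite Y A).of_injective
          (f := ((kernel.ι ((linearCoyoneda k C).map f.op)).app A).hom)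
          (NatTrans.kernel_ι_app_injective _ A)
      exact IsFPCov.of_iso (asIso (evalCov E _)) (hCov (isFPContra_dualizeCov_kernel _
        (hContra (isFPCov_linearCoyoneda Y)) (hContra (isFPCov_linearCoyoneda X))))
  · rintro ⟨⟨hker, hcoker⟩, hrep⟩
    refine ⟨fun F => isFPCov_dualizeContra_of_isFPContra hcoker (fun c => (hrep c).1) F.property,
      { faithful := ⟨fun {F₁ F₂ α β} h => ?_⟩
        full := ⟨fun {F₁ F₂} γ => ?_⟩
        essSurj := ⟨fun G => ?_⟩ }⟩
    · refine Quiver.Hom.unop_inj (ObjectProperty.hom_ext _ (hE.dualizeContra_map_injective ?_))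
      exact congrArg (fun δ => δ.hom) h
    · obtain ⟨α, hα⟩ := hE.dualizeContra_map_surjective (finContra F₁.unop.property) γ.hom
      exact ⟨Quiver.Hom.op (ObjectProperty.homMk α), ObjectProperty.hom_ext _ hα⟩
    · have := hE.isIso_evalCov G.obj (finCov G.property)
      refine ⟨op ⟨(dualizeCov k E C).obj (op G.obj),
        isFPContra_dualizeCov_of_isFPCov hker (fun c => (hrep c).2) G.property⟩, ⟨?_⟩⟩
      exact ObjectProperty.isoMk _ (asIso (evalCov E G.obj)).symm
end

section
/- Every dualising k-variety C has right determined morphisms; that is: (1) for every pair of objects C, Y of C and every End_C(C)-submodule H ⊆ Hom_C(C, Y), there exists a right C-determined morphism α : X → Y with Im Hom_C(C, α) = H; and (2) every morphism ending in any object Y of C is right determined by some object of C. -/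
open CategoryTheory CategoryTheory.Limits Opposite

universe v u

/-- The left action of `(End c)ᵐᵒᵖ` on `c ⟶ X` given by precomposition; this encodes the
structure of `Hom(c, X)` as a module over `Γ = End c` acting by precomposition. -/
instance endOpModule {C : Type*} [Category C] [Preadditive C] (c X : C) :
    Module (End c)ᵐᵒᵖ (c ⟶ X) where
  smul γ f := γ.unop ≫ f
  one_smul f := Category.id_comp f
  mul_smul γ₁ γ₂ f := by
    show ((γ₁ * γ₂).unop) ≫ f = γ₁.unop ≫ (γ₂.unop ≫ f)
    rw [MulOpposite.unop_mul]
    show (γ₁.unop ≫ γ₂.unop) ≫ f = _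
    simp
  smul_zero γ := Limits.comp_zero
  smul_add γ f g := Preadditive.comp_add _ _ _ _ _ _
  add_smul γ₁ γ₂ f := Preadditive.add_comp _ _ _ _ _ _
  zero_smul f := Limits.zero_comp

theorem endOpModule_smul_def {C : Type*} [Category C] [Preadditive C] {c X : C}
    (γ : (End c)ᵐᵒᵖ) (f : c ⟶ X) : γ • f = γ.unop ≫ f := rfl
theorem IsArtinianRing.exists_notMem_forall_mul_mem_jacobson {k : Type*} [CommRing k]
    [IsArtinianRing k] (m : Ideal k) [hm : m.IsMaximal] :
    ∃ x ∉ m, ∀ a ∈ m, a * x ∈ (⊥ : Ideal k).jacobson := by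
  classical
  have := Fintype.ofFinite (MaximalSpectrum k)
  let s : Finset (MaximalSpectrum k) := Finset.univ.erase ⟨m, hm⟩
  have hs : ¬ s.inf MaximalSpectrum.asIdeal ≤ m := by
    rw [hm.isPrime.inf_le']
    rintro ⟨n, hn, hle⟩
    exact Finset.ne_of_mem_erase hn (MaximalSpectrum.ext (n.isMaximal.eq_of_le hm.ne_top hle))
  obtain ⟨x, hx, hxm⟩ := SetLike.not_le_iff_exists.mp hs
  refine ⟨x, hxm, fun a ha => ?_⟩
  rw [Ideal.jacobson, Submodule.mem_sInf]
  rintro J ⟨-, hJ⟩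
  by_cases h : J = m
  · exact h ▸ m.mul_mem_right x ha
  · refine Ideal.mul_mem_left J a ?_
    rw [Submodule.mem_finsetInf] at hx
    exact hx ⟨J, hJ⟩ (Finset.mem_erase.mpr
      ⟨fun e => h (congrArg MaximalSpectrum.asIdeal e), Finset.mem_univ _⟩)

/-- An injective envelope of `k/𝔯` is a cogenerator: it separates elements of modules from
submodules. -/
theorem IsInjectiveEnvelopeOfResidueField.exists_linearMap_ne_zero {k : Type v} [CommRing k]
    [IsArtinianRing k] {E : Type v} [AddCommGroup E] [Module k E]
    (hE : IsInjectiveEnvelopeOfResidueField k E) {M : Type v} [AddCommGroup M] [Module k M]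
    (N : Submodule k M) {x : M} (hx : x ∉ N) :
    ∃ ξ : M →ₗ[k] E, N ≤ LinearMap.ker ξ ∧ ξ x ≠ 0 := by
  obtain ⟨hinj, i, hi, -⟩ := hE
  let y : M ⧸ N := N.mkQ x
  have hy : y ≠ 0 := by simpa [y] using hx
  let I : Ideal k := LinearMap.ker (LinearMap.toSpanSingleton k (M ⧸ N) y)
  have hI : I ≠ ⊤ := fun h => hy (by
    have : (1 : k) ∈ I := h ▸ Submodule.mem_top
    simpa [I] using this)
  obtain ⟨m, hm, hIm⟩ := Ideal.exists_le_maximal I hI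
  obtain ⟨z, hzm, hz⟩ := IsArtinianRing.exists_notMem_forall_mul_mem_jacobson m
  let e : E := i (Ideal.Quotient.mk _ z)
  have he : e ≠ 0 := by
    intro h
    rw [map_eq_zero_iff i hi, Ideal.Quotient.eq_zero_iff_mem] at h
    exact hzm (Ideal.mem_sInf.mp h ⟨bot_le, hm⟩)
  have hIe : I ≤ LinearMap.ker (LinearMap.toSpanSingleton k E e) := by
    intro a ha
    have hmk : a • (Ideal.Quotient.mk (⊥ : Ideal k).jacobson z) = 0 := by
      rw [Algebra.smul_def, Ideal.Quotient.algebraMap_eq, ← map_mul,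
        Ideal.Quotient.eq_zero_iff_mem]
      exact hz a (hIm ha)
    rw [LinearMap.mem_ker, LinearMap.toSpanSingleton_apply, ← map_smul, hmk, map_zero]
  obtain ⟨h, hh⟩ := hinj.out (I.liftQ (LinearMap.toSpanSingleton k (M ⧸ N) y) le_rfl)
    (LinearMap.ker_eq_bot.mp (Submodule.ker_liftQ_eq_bot _ _ _ le_rfl))
    (I.liftQ (LinearMap.toSpanSingleton k E e) hIe)
  refine ⟨h ∘ₗ N.mkQ, fun a ha => ?_, ?_⟩
  · rw [LinearMap.mem_ker, LinearMap.comp_apply, Submodule.mkQ_apply,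
      (Submodule.Quotient.mk_eq_zero N).mpr ha, map_zero]
  · have := hh (I.mkQ 1)
    simp only [Submodule.mkQ_apply, Submodule.liftQ_apply, LinearMap.toSpanSingleton_apply,
      one_smul] at this
    rw [LinearMap.comp_apply]
    exact this.trans_ne he

/-- In an artinian module, a submodule is cut out by finitely many linear maps to a
cogenerator. -/
theorem IsInjectiveEnvelopeOfResidueField.exists_finset_linearMap {k : Type v} [CommRing k]
    [IsArtinianRing k] {E : Type v} [AddCommGroup E] [Module k E]
    (hE : IsInjectiveEnvelopeOfResidueField k E) {M : Type v} [AddCommGroup M] [Module k M]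
    [IsArtinian k M] (N : Submodule k M) :
    ∃ s : Finset (M →ₗ[k] E), ∀ x, x ∈ N ↔ ∀ ξ ∈ s, ξ x = 0 := by
  classical
  obtain ⟨K, ⟨s, hsN, rfl⟩, hmin⟩ := IsArtinian.set_has_minimal
    {K : Submodule k M | ∃ s : Finset (M →ₗ[k] E), (∀ ξ ∈ s, N ≤ LinearMap.ker ξ) ∧
      K = s.inf LinearMap.ker} ⟨⊤, ∅, by simp, by simp⟩
  refine ⟨s, fun x => ⟨fun hx ξ hξ => hsN ξ hξ hx, fun hx => ?_⟩⟩
  by_contra hxN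
  obtain ⟨ξ, hξN, hξx⟩ := hE.exists_linearMap_ne_zero N hxN
  refine hmin ((insert ξ s).inf LinearMap.ker) ⟨insert ξ s, by simpa using ⟨hξN, hsN⟩, rfl⟩ ?_
  rw [Finset.inf_insert]
  refine lt_of_le_of_ne inf_le_right fun h => hξx ?_
  have : x ∈ s.inf LinearMap.ker := by
    rw [Submodule.mem_finsetInf]
    exact hx
  rw [← h] at this
  exact this.1

section Cokernel

variable {k : Type v} [CommRing k] {J : Type*} [Category J] {F G : J ⥤ ModuleCat.{v} k}

theorem cokernel_π_app_surjective (f : F ⟶ G) (j : J) :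
    Function.Surjective ((cokernel.π f).app j) :=
  (ModuleCat.epi_iff_surjective _).mp inferInstance

theorem cokernel_π_app_eq_zero_iff (f : F ⟶ G) (j : J) (x : G.obj j) :
    (cokernel.π f).app j x = 0 ↔ ∃ y, f.app j y = x := by
  have hex := (ShortComplex.exact_cokernel f).map_of_epi_of_preservesCokernel
    ((evaluation J (ModuleCat k)).obj j) inferInstance inferInstance
  refine ⟨fun h => (ShortComplex.moduleCat_exact_iff _).mp hex x h, ?_⟩
  rintro ⟨y, rfl⟩
  have := congrArg (fun t => t.app j) (cokernel.condition f)
  exact DFunLike.congr_fun (congrArg ModuleCat.Hom.hom this) y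

end Cokernel

section Dualising

variable {k : Type v} [CommRing k] {E : Type v} [AddCommGroup E] [Module k E]
variable {C : Type u} [Category.{v} C] [Preadditive C] [Linear k C]

/-- A presentation of a covariant functor by corepresentable functors, in terms of elements. -/
theorem IsFPCov.exists_presentation {G : C ⥤ ModuleCat.{v} k} (hG : IsFPCov k C G) :
    ∃ (A B : C) (p : A ⟶ B) (ρ : (linearCoyoneda k C).obj (op A) ⟶ G),
      (∀ X, Function.Surjective (ρ.app X)) ∧
      (∀ X (g : A ⟶ X), ρ.app X g = 0 ↔ ∃ h : B ⟶ X, p ≫ h = g) ∧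
      ∀ {K : C ⥤ ModuleCat.{v} k} (τ : (linearCoyoneda k C).obj (op A) ⟶ K),
        (linearCoyoneda k C).map p.op ≫ τ = 0 → ∃ t : G ⟶ K, ρ ≫ t = τ := by
  obtain ⟨A, B, p, ⟨e⟩⟩ := hG
  have he : ∀ X, Function.Bijective (e.inv.app X) := fun X =>
    (ConcreteCategory.isIso_iff_bijective _).mp inferInstance
  refine ⟨A, B, p, cokernel.π _ ≫ e.inv, fun X => ?_, fun X g => ?_,
    fun τ hτ => ⟨e.hom ≫ cokernel.desc _ τ hτ, by simp⟩⟩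
  · exact (he X).2.comp (cokernel_π_app_surjective _ X)
  · refine Iff.trans ?_ (cokernel_π_app_eq_zero_iff ((linearCoyoneda k C).map p.op) X g)
    exact map_eq_zero_iff (e.inv.app X).hom (he X).1

/-- A presentation of a contravariant functor has a generating representable functor. -/
theorem IsFPContra.exists_surjective {F : Cᵒᵖ ⥤ ModuleCat.{v} k} (hF : IsFPContra k C F) :
    ∃ (X : C) (ρ : (linearYoneda k C).obj X ⟶ F), ∀ Z, Function.Surjective (ρ.app Z) := by
  obtain ⟨A, B, p, ⟨e⟩⟩ := hF
  refine ⟨B, cokernel.π _ ≫ e.inv, fun X => ?_⟩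
  exact ((ConcreteCategory.isIso_iff_bijective (e.inv.app X)).mp inferInstance).2.comp
    (cokernel_π_app_surjective _ X)

theorem linearYoneda_isFPContra (Y : C) : IsFPContra k C ((linearYoneda k C).obj Y) := by
  have h : (linearYoneda k C).map (0 : Y ⟶ Y) = 0 := by
    ext Z f
    exact Limits.comp_zero
  exact ⟨Y, Y, 0, ⟨cokernelZeroIsoTarget.symm ≪≫ cokernelIsoOfEq h.symm⟩⟩

theorem coyoneda_app_eq_map {G : C ⥤ ModuleCat.{v} k} {A X : C}
    (ρ : (linearCoyoneda k C).obj (op A) ⟶ G) (g : A ⟶ X) :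
    ρ.app X g = G.map g (ρ.app A (𝟙 A)) := by
  have h := DFunLike.congr_fun (congrArg ModuleCat.Hom.hom (ρ.naturality g)) (𝟙 A)
  refine Eq.trans ?_ h
  exact congrArg (ρ.app X) (Category.id_comp g).symm

theorem RightDetermined.exists_of_isDualisingVariety [IsArtinianRing k]
    (hE : IsInjectiveEnvelopeOfResidueField k E) (hdv : IsDualisingVariety k E C)
    {X Y : C} (α : X ⟶ Y) : ∃ c : C, RightDetermined α c := by
  obtain ⟨h, -⟩ := hdv
  let F := cokernel ((linearYoneda k C).map α)
  obtain ⟨A, B, p, ρ, hρ, -⟩ := (h ⟨F, X, Y, α, ⟨Iso.refl _⟩⟩).exists_presentation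
  have hF : ∀ {Z : C} (f : Z ⟶ Y),
      FactorsThru f α ↔ (cokernel.π ((linearYoneda k C).map α)).app (op Z) f = 0 := fun f =>
    (cokernel_π_app_eq_zero_iff ((linearYoneda k C).map α) _ f).symm
  refine ⟨A, fun X' α' => ⟨?_, fun hα' => ?_⟩⟩
  · rintro ⟨ψ, rfl⟩ φ
    exact ⟨φ ≫ ψ, Category.assoc _ _ _⟩
  · rw [hF]
    by_contra hne
    obtain ⟨η, -, hη⟩ := hE.exists_linearMap_ne_zero (M := F.obj (op X')) ⊥ hne
    obtain ⟨g, hg⟩ := hρ X' (ModuleCat.ofHom η)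
    rw [coyoneda_app_eq_map ρ g] at hg
    let ξ : F.obj (op A) ⟶ ModuleCat.of k E := ρ.app A (𝟙 A)
    have hg' : F.map g.op ≫ ξ = ModuleCat.ofHom η := hg
    apply hη
    have h1 := DFunLike.congr_fun (congrArg ModuleCat.Hom.hom hg')
      ((cokernel.π ((linearYoneda k C).map α)).app (op X') α')
    refine h1.symm.trans ?_
    have h2 : F.map g.op ((cokernel.π ((linearYoneda k C).map α)).app (op X') α') = 0 := by
      refine Eq.trans ?_ ((hF _).mp (hα' g))
      exact (DFunLike.congr_fun (congrArg ModuleCat.Hom.hom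
        ((cokernel.π ((linearYoneda k C).map α)).naturality g.op)) α').symm
    exact (congrArg ξ.hom h2).trans (map_zero _)

/-- For a linear form `ξ` on `Hom(c, Y)`, the subfunctor of `Hom(-, Y)` of those morphisms `f`
with `ξ (φ ≫ f) = 0` for all `φ` is generated by a single morphism. -/
theorem exists_generator_of_linearForm [IsArtinianRing k] [HasBinaryBiproducts C]
    (hE : IsInjectiveEnvelopeOfResidueField k E) (hdv : IsDualisingVariety k E C)
    {c Y : C} (ξ : (c ⟶ Y) →ₗ[k] E) :
    ∃ (X : C) (α : X ⟶ Y), ∀ {Z : C} (f : Z ⟶ Y),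
      FactorsThru f α ↔ ∀ φ : c ⟶ Z, ξ (φ ≫ f) = 0 := by
  obtain ⟨h, hequiv⟩ := hdv
  let y : ObjectProperty.FullSubcategory (IsFPContra k C) :=
    ⟨(linearYoneda k C).obj Y, linearYoneda_isFPContra Y⟩
  obtain ⟨A, B, p, ρ, hρ, hker, hdesc⟩ := (h y).exists_presentation
  obtain ⟨q, hq⟩ := hρ c (ModuleCat.ofHom ξ)
  change A ⟶ c at q
  let p' : A ⟶ B ⊞ c := biprod.lift p q
  have hp'fst : p' ≫ biprod.fst = p := biprod.lift_fst p q
  have hp'snd : p' ≫ biprod.snd = q := biprod.lift_snd p q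
  let Q := cokernel ((linearCoyoneda k C).map p'.op)
  obtain ⟨t, ht⟩ := hdesc (cokernel.π ((linearCoyoneda k C).map p'.op)) (by
    have : p.op = (biprod.fst : B ⊞ c ⟶ B).op ≫ p'.op := by
      rw [← op_comp, hp'fst]
    rw [this, Functor.map_comp, Category.assoc, cokernel.condition, comp_zero])
  let Φ := ObjectProperty.lift (IsFPCov k C)
    ((ObjectProperty.ι (IsFPContra k C)).op ⋙ dualizeContra k E C) (fun F => h F.unop)
  have : Φ.IsEquivalence := hequiv
  let Q' : ObjectProperty.FullSubcategory (IsFPCov k C) := ⟨Q, A, B ⊞ c, p', ⟨Iso.refl _⟩⟩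
  let w := Φ.objPreimage Q'
  let e : Φ.obj w ≅ Q' := Φ.objObjPreimageIso Q'
  let t' : Φ.obj (op y) ⟶ Q' := ObjectProperty.homMk t
  obtain ⟨j', hj'⟩ := Φ.map_surjective (t' ≫ e.inv)
  let j : w.unop.obj ⟶ (linearYoneda k C).obj Y := j'.unop.hom
  have hj : (dualizeContra k E C).map j.op = t ≫ e.inv.hom :=
    congrArg (ObjectProperty.ι (IsFPCov k C)).map hj'
  have he : ∀ Z, Function.Injective (e.inv.hom.app Z) := fun Z =>
    ((ConcreteCategory.isIso_iff_bijective (((ObjectProperty.ι _).mapIso e).inv.app Z)).mp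
      inferInstance).1
  -- The forms on `Hom(Z, Y)` that vanish on the image of `j`, in terms of the presentation.
  have hvanish : ∀ {Z : C} (g : A ⟶ Z),
      j.app (op Z) ≫ (ρ.app Z g : ModuleCat.of k (Z ⟶ Y) ⟶ ModuleCat.of k E) = 0 ↔
        ∃ h : B ⊞ c ⟶ Z, p' ≫ h = g := by
    intro Z g
    refine Iff.trans ?_ (cokernel_π_app_eq_zero_iff ((linearCoyoneda k C).map p'.op) Z g)
    refine Iff.trans ?_ (map_eq_zero_iff (e.inv.hom.app Z).hom (he Z))
    have h1 : ρ ≫ (dualizeContra k E C).map j.op =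
        cokernel.π ((linearCoyoneda k C).map p'.op) ≫ e.inv.hom := by
      rw [hj, ← Category.assoc, ht]
    exact Eq.congr_left (DFunLike.congr_fun (congrArg (fun s => (s.app Z).hom) h1) g)
  have hform : ∀ {Z : C} (φ : c ⟶ Z) (f : Z ⟶ Y),
      (ρ.app Z (q ≫ φ) : ModuleCat.of k (Z ⟶ Y) ⟶ ModuleCat.of k E).hom f = ξ (φ ≫ f) := by
    intro Z φ f
    have h1 := DFunLike.congr_fun (congrArg ModuleCat.Hom.hom (ρ.naturality φ)) q
    have h2 : ρ.app Z (q ≫ φ) =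
        ((dualizeContra k E C).obj (op y.obj)).map φ (ModuleCat.ofHom ξ) :=
      h1.trans (congrArg (((dualizeContra k E C).obj (op y.obj)).map φ) hq)
    rw [h2]
    rfl
  obtain ⟨X, σ, hσ⟩ := w.unop.property.exists_surjective
  let α : X ⟶ Y := j.app (op X) (σ.app (op X) (𝟙 X))
  have hα : ∀ {Z : C} (ψ : Z ⟶ X), j.app (op Z) (σ.app (op Z) ψ) = ψ ≫ α := by
    intro Z ψ
    have h1 := DFunLike.congr_fun (congrArg ModuleCat.Hom.hom ((σ ≫ j).naturality ψ.op)) (𝟙 X)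
    refine Eq.trans ?_ h1
    exact congrArg ((σ ≫ j).app (op Z)) (Category.comp_id ψ).symm
  have hrange : ∀ {Z : C} (f : Z ⟶ Y),
      FactorsThru f α ↔ f ∈ LinearMap.range (j.app (op Z)).hom := by
    intro Z f
    constructor
    · rintro ⟨ψ, rfl⟩
      exact ⟨_, hα ψ⟩
    · rintro ⟨x, rfl⟩
      obtain ⟨ψ, rfl⟩ := hσ _ x
      exact ⟨ψ, (hα ψ).symm⟩
  refine ⟨X, α, fun {Z} f => (hrange f).trans ⟨?_, fun hf => ?_⟩⟩
  · rintro ⟨x, rfl⟩ φ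
    refine (hform φ _).symm.trans ?_
    have h0 := (hvanish (q ≫ φ)).mpr ⟨biprod.snd ≫ φ, by rw [← Category.assoc, hp'snd]⟩
    exact DFunLike.congr_fun (congrArg ModuleCat.Hom.hom h0) x
  · by_contra hne
    obtain ⟨η, hηN, hη⟩ := hE.exists_linearMap_ne_zero _ hne
    obtain ⟨g, hg⟩ := hρ Z (ModuleCat.ofHom η)
    obtain ⟨s, hs⟩ := (hvanish g).mp (by
      rw [hg]
      ext x
      exact hηN ⟨x, rfl⟩)
    have hsplit : g = p ≫ biprod.inl ≫ s + q ≫ biprod.inr ≫ s := by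
      rw [← hs, ← hp'fst, ← hp'snd, Category.assoc, Category.assoc, ← Preadditive.comp_add,
        ← Category.assoc, ← Category.assoc biprod.snd, ← Preadditive.add_comp, biprod.total,
        Category.id_comp]
    have hg' : ρ.app Z g = ρ.app Z (q ≫ biprod.inr ≫ s) := by
      rw [hsplit]
      refine (map_add (ρ.app Z).hom _ _).trans ?_
      have h0 := (hker Z (p ≫ biprod.inl ≫ s)).mpr ⟨_, rfl⟩
      exact (congrArg (· + _) h0).trans (zero_add _)
    apply hη
    have h3 := hform (biprod.inr ≫ s) f
    rw [← hg', hg] at h3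
    exact h3.trans (hf _)

theorem exists_generator_of_finset_linearForm [IsArtinianRing k] [HasFiniteBiproducts C]
    (hE : IsInjectiveEnvelopeOfResidueField k E) (hdv : IsDualisingVariety k E C)
    {c Y : C} (s : Finset ((c ⟶ Y) →ₗ[k] E)) :
    ∃ (X : C) (α : X ⟶ Y), ∀ {Z : C} (f : Z ⟶ Y),
      FactorsThru f α ↔ ∀ φ : c ⟶ Z, ∀ ξ ∈ s, ξ (φ ≫ f) = 0 := by
  classical
  have : HasBinaryBiproducts C := hasBinaryBiproducts_of_finite_biproducts C
  let b : s → C := fun _ => c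
  let ξ : ((⨁ b) ⟶ Y) →ₗ[k] E :=
    ∑ i : s, (i : (c ⟶ Y) →ₗ[k] E) ∘ₗ Linear.leftComp k Y (biproduct.ι b i)
  have hξ : ∀ g, ξ g = ∑ i : s, (i : (c ⟶ Y) →ₗ[k] E) (biproduct.ι b i ≫ g) := fun g => by
    simp [ξ]
  obtain ⟨X, α, hα⟩ := exists_generator_of_linearForm hE hdv ξ
  refine ⟨X, α, fun {Z} f => (hα f).trans ⟨fun h φ i hi => ?_, fun h φ => ?_⟩⟩
  · have h1 := h (biproduct.π b ⟨i, hi⟩ ≫ φ)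
    rw [hξ, Finset.sum_eq_single_of_mem ⟨i, hi⟩ (Finset.mem_univ _)] at h1
    · rwa [← Category.assoc, ← Category.assoc, biproduct.ι_π_self, Category.id_comp] at h1
    · intro i' _ hne
      rw [← Category.assoc, ← Category.assoc, biproduct.ι_π_ne _ hne, zero_comp, zero_comp,
        map_zero]
  · rw [hξ]
    refine Finset.sum_eq_zero fun i _ => ?_
    rw [← Category.assoc]
    exact h _ i i.2

end Dualising

/-- Corollary `co:dual` with Definition `de:det`.  Every dualising
`k`-variety has right determined morphisms: (1) for all objects `c, Y` and every
`End_C(c)`-submodule `H ⊆ Hom_C(c, Y)` (for the action by precomposition) there is a right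
`c`-determined morphism `α : X ⟶ Y` with `Im Hom_C(c, α) = H`; (2) every morphism ending in
any object of `C` is right determined by some object of `C`. -/
theorem stmt_13 {k : Type v} [CommRing k] [IsArtinianRing k]
    (E : Type v) [AddCommGroup E] [Module k E]
    (hE : IsInjectiveEnvelopeOfResidueField k E)
    {C : Type u} [Category.{v} C] [Preadditive C] [Linear k C] [HasFiniteBiproducts C]
    [EssentiallySmall.{v} C] [IsIdempotentComplete C]
    (homFinite : ∀ A B : C, IsFiniteLength k (A ⟶ B))
    (hdv : IsDualisingVariety k E C) :
    (∀ (c Y : C) (H : Submodule (End c)ᵐᵒᵖ (c ⟶ Y)),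
      ∃ (X : C) (α : X ⟶ Y), RightDetermined α c ∧ ImHom c α = (H : Set (c ⟶ Y))) ∧
    (∀ ⦃X Y : C⦄ (α : X ⟶ Y), ∃ c : C, RightDetermined α c) := by
  refine ⟨fun c Y H => ?_, fun X Y α => RightDetermined.exists_of_isDualisingVariety hE hdv α⟩
  have : IsArtinian k (c ⟶ Y) := (isFiniteLength_iff_isNoetherian_isArtinian.mp (homFinite c Y)).2
  let N : Submodule k (c ⟶ Y) :=
    { H.toAddSubmonoid with
      smul_mem' := fun a f hf => by
        have h := H.smul_mem (MulOpposite.op (a • 𝟙 c : End c)) hf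
        have e : (a • 𝟙 c) ≫ f = a • f := by rw [Linear.smul_comp, Category.id_comp]
        exact e ▸ h }
  obtain ⟨s, hs⟩ := hE.exists_finset_linearMap N
  obtain ⟨X, α, hα⟩ := exists_generator_of_finset_linearForm hE hdv s
  have hα' : ∀ {Z : C} (f : Z ⟶ Y), FactorsThru f α ↔ ∀ φ : c ⟶ Z, φ ≫ f ∈ H := fun f =>
    (hα f).trans (forall_congr' fun φ => (hs (φ ≫ f)).symm)
  have hH : ∀ f : c ⟶ Y, FactorsThru f α ↔ f ∈ H := fun f =>
    (hα' f).trans ⟨fun h => Category.id_comp f ▸ h (𝟙 c),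
      fun hf φ => H.smul_mem (MulOpposite.op (φ : End c)) hf⟩
  exact ⟨X, α, fun X' α' => (hα' α').trans (forall_congr' fun φ => (hH _).symm), Set.ext hH⟩
end
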